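/- arXiv:2006.14367 — 6 statements merged into one kernel-verified Lean document; each statement's English description precedes it below -/
import Mathlib

section
/- Let b > 0, h > 0, g > 0, ν³ > 0 be real numbers, v = (v¹,v²) ∈ ℝ², n = (n₁,n₂) ∈ ℝ², and let β = (β^{ab}) be a symmetric 2×2 real matrix. For λ ∈ ℝ set δ := v¹n₁ + v²n₂ − λ and define the 3×3 real matrix M(λ) := b · [[δ, h n₁, h n₂], [v¹δ + gν³h(β^{11}n₁ + β^{12}n₂), hδ + hv¹n₁, hv¹n₂], [v²δ + gν³h(β^{21}n₁ + β^{22}n₂), hv²n₁, hδ + hv²n₂]]. Then det M(λ) = b³ h² δ (δ² − gν³h · (β^{11}n₁² + 2β^{12}n₁n₂ + β^{22}n₂²)). -/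
/-- the characteristic determinant of the shallow-water-with-vegetation
quasilinear system.  Here `b` stands for the product `βθ`, `ν3` for the vertical
component of the unit normal, and `β` is the (symmetric) contravariant terrain metric. -/
theorem det_characteristic_matrix_swe_vegetation
    (b h g ν3 : ℝ) (hb : 0 < b) (hh : 0 < h) (hg : 0 < g) (hν3 : 0 < ν3)
    (v1 v2 n1 n2 : ℝ) (β : Matrix (Fin 2) (Fin 2) ℝ) (hβ : β.IsSymm) (lam : ℝ) :
    let δ : ℝ := v1 * n1 + v2 * n2 - lam
    let M : Matrix (Fin 3) (Fin 3) ℝ :=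
      b • !![δ, h * n1, h * n2;
             v1 * δ + g * ν3 * h * (β 0 0 * n1 + β 0 1 * n2),
               h * δ + h * v1 * n1, h * v1 * n2;
             v2 * δ + g * ν3 * h * (β 1 0 * n1 + β 1 1 * n2),
               h * v2 * n1, h * δ + h * v2 * n2]
    M.det = b ^ 3 * h ^ 2 * δ *
      (δ ^ 2 - g * ν3 * h * (β 0 0 * n1 ^ 2 + 2 * β 0 1 * n1 * n2 + β 1 1 * n2 ^ 2)) := by
  intro δ M
  have h10 : β 1 0 = β 0 1 := hβ.apply 0 1
  have hM : M.det = b ^ 3 * Matrix.det !![δ, h * n1, h * n2;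
             v1 * δ + g * ν3 * h * (β 0 0 * n1 + β 0 1 * n2),
               h * δ + h * v1 * n1, h * v1 * n2;
             v2 * δ + g * ν3 * h * (β 1 0 * n1 + β 1 1 * n2),
               h * v2 * n1, h * δ + h * v2 * n2] := by
    simp only [M, Matrix.det_smul, Fintype.card_fin]
  rw [hM, h10]
  clear_value δ
  rw [Matrix.det_fin_three]
  simp
  ring
end

section
/- Let b > 0, h > 0, g > 0, ν³ > 0 be real numbers, v = (v¹,v²) ∈ ℝ², and n = (n₁,n₂) ∈ ℝ² and β = (β^{ab}) a symmetric 2×2 real matrix with β^{11}n₁² + 2β^{12}n₁n₂ + β^{22}n₂² = 1. For λ ∈ ℝ set δ := v¹n₁ + v²n₂ − λ and M(λ) := b · [[δ, h n₁, h n₂], [v¹δ + gν³h(β^{11}n₁ + β^{12}n₂), hδ + hv¹n₁, hv¹n₂], [v²δ + gν³h(β^{21}n₁ + β^{22}n₂), hv²n₁, hδ + hv²n₂]]. Then det M(λ) = 0 if and only if λ ∈ {v¹n₁+v²n₂ − √(gν³h), v¹n₁+v²n₂, v¹n₁+v²n₂ + √(gν³h)}, and these three values are pairwise distinct real numbers.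 -/
/-- the eigenvalue problem for the shallow-water-with-vegetation system.
With `n` a unit covector for the contravariant terrain metric `β`, the characteristic
determinant vanishes exactly at the three pairwise distinct speeds
`v·n − √(gν³h)`, `v·n`, `v·n + √(gν³h)`. -/
theorem eigenvalues_swe_vegetation
    (b h g ν3 : ℝ) (hb : 0 < b) (hh : 0 < h) (hg : 0 < g) (hν3 : 0 < ν3)
    (v1 v2 n1 n2 : ℝ) (β : Matrix (Fin 2) (Fin 2) ℝ) (hβ : β.IsSymm)
    (hn : β 0 0 * n1 ^ 2 + 2 * β 0 1 * n1 * n2 + β 1 1 * n2 ^ 2 = 1) (lam : ℝ) :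
    let δ : ℝ := v1 * n1 + v2 * n2 - lam
    let M : Matrix (Fin 3) (Fin 3) ℝ :=
      b • !![δ, h * n1, h * n2;
             v1 * δ + g * ν3 * h * (β 0 0 * n1 + β 0 1 * n2),
               h * δ + h * v1 * n1, h * v1 * n2;
             v2 * δ + g * ν3 * h * (β 1 0 * n1 + β 1 1 * n2),
               h * v2 * n1, h * δ + h * v2 * n2]
    (M.det = 0 ↔
        lam = v1 * n1 + v2 * n2 - Real.sqrt (g * ν3 * h) ∨
        lam = v1 * n1 + v2 * n2 ∨
        lam = v1 * n1 + v2 * n2 + Real.sqrt (g * ν3 * h)) ∧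
      (v1 * n1 + v2 * n2 - Real.sqrt (g * ν3 * h) ≠ v1 * n1 + v2 * n2 ∧
       v1 * n1 + v2 * n2 - Real.sqrt (g * ν3 * h) ≠
         v1 * n1 + v2 * n2 + Real.sqrt (g * ν3 * h) ∧
       v1 * n1 + v2 * n2 ≠ v1 * n1 + v2 * n2 + Real.sqrt (g * ν3 * h)) := by
  intro δ M
  have hs : 0 < Real.sqrt (g * ν3 * h) := Real.sqrt_pos.mpr (by positivity)
  have hs2 : Real.sqrt (g * ν3 * h) ^ 2 = g * ν3 * h := Real.sq_sqrt (by positivity)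
  have h10 : β 1 0 = β 0 1 := hβ.apply 0 1
  have hdet : M.det = b ^ 3 * h ^ 2 * (δ * ((δ - Real.sqrt (g * ν3 * h)) *
      (δ + Real.sqrt (g * ν3 * h)))) := by
    have e : (δ - Real.sqrt (g * ν3 * h)) * (δ + Real.sqrt (g * ν3 * h))
        = δ ^ 2 - g * ν3 * h := by
      linear_combination -hs2
    rw [e]
    simp only [M, Matrix.det_fin_three, Matrix.smul_apply, smul_eq_mul, h10]
    simp
    linear_combination (-(b ^ 3 * h ^ 2 * δ * (g * ν3 * h))) * hn
  refine ⟨?_, ?_, ?_, ?_⟩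
  · have hc : b ^ 3 * h ^ 2 ≠ 0 := by positivity
    rw [hdet, mul_eq_zero, or_iff_right hc, mul_eq_zero, mul_eq_zero]
    simp only [δ]
    constructor
    · rintro (H | H | H)
      · right; left; linarith
      · left; linarith
      · right; right; linarith
    · rintro (H | H | H)
      · right; left; linarith
      · left; linarith
      · right; right; linarith
  · intro H; linarith
  · intro H; linarith
  · intro H; linarith
end

section
/- Let β, θ, ν³, b³ : D → ℝ be continuously differentiable functions on an open set D ⊆ ℝ² with ν³ > 0 on D, let β^{ab}, γ^c_{ab}, 𝒦 : D → ℝ (a,b,c ∈ {1,2}) be arbitrary continuous coefficient functions, let g > 0, and let C ∈ ℝ. Define h(y¹,y²,t) := (C − b³(y¹,y²))/ν³(y¹,y²) and v¹ := 0, v² := 0, and assume zero rain and infiltration rates (𝔪_r = 𝔪_i = 0). Then (h, v¹, v²) satisfies the full shallow-water system with vegetation: ∂_t(hβθ) + ∂_a(hβθ v^a) = β(𝔪_r − θ𝔪_i) and, for c = 1,2, ∂_t(hθβv^c) + ∂_a(θβ h v^c v^a) + hθβ γ^c_{ab} v^a v^b + hβθ β^{ca} ∂_a w = −β𝒦 |v|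 v^c, where w = g(b³ + hν³). In other words, the full model preserves the steady state of a lake b³ + hν³ = constant. -/
/-- Partial derivative with respect to the first space variable `y¹`
(points of `ℝ × ℝ × ℝ` are `(y¹, y², t)`). -/
noncomputable def pd1 (f : ℝ × ℝ × ℝ → ℝ) (p : ℝ × ℝ × ℝ) : ℝ :=
  fderiv ℝ f p (1, 0, 0)

/-- Partial derivative with respect to the second space variable `y²`. -/
noncomputable def pd2 (f : ℝ × ℝ × ℝ → ℝ) (p : ℝ × ℝ × ℝ) : ℝ :=
  fderiv ℝ f p (0, 1, 0)

/-- Partial derivative with respect to time `t`. -/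
noncomputable def pdt (f : ℝ × ℝ × ℝ → ℝ) (p : ℝ × ℝ × ℝ) : ℝ :=
  fderiv ℝ f p (0, 0, 1)

/-- A function not depending on time has zero time derivative. -/
theorem pdt_of_space (G : ℝ × ℝ → ℝ) (p : ℝ × ℝ × ℝ) :
    pdt (fun q => G (q.1, q.2.1)) p = 0 := by
  unfold pdt
  by_cases hd : DifferentiableAt ℝ (fun q : ℝ × ℝ × ℝ => G (q.1, q.2.1)) p
  · rw [← hd.lineDeriv_eq_fderiv]
    simp [lineDeriv]
  · simp [fderiv_zero_of_not_differentiableAt hd]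

/-- the full averaged shallow-water model with vegetation preserves the
steady state of a lake `b³ + hν³ = constant`: with `h := (C − b³)/ν³`, `v¹ = v² = 0` and
zero rain and infiltration rates, the mass and momentum equations hold on `D`.
Here `β` is the area factor of the terrain metric, `θ` the porosity, `ν³` the vertical
component of the unit normal, `b³` the vertical coordinate of the terrain,
`βab` the contravariant metric components, `γ c a b` the Christoffel symbols,
`𝒦` the friction coefficient and `w = g(b³ + hν³)`. -/
theorem lake_steady_state_full_swe
    (D : Set (ℝ × ℝ)) (hD : IsOpen D)
    (β θ ν3 b3 : ℝ × ℝ → ℝ)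
    (hβ : ContDiffOn ℝ 1 β D) (hθ : ContDiffOn ℝ 1 θ D)
    (hν3 : ContDiffOn ℝ 1 ν3 D) (hb3 : ContDiffOn ℝ 1 b3 D)
    (hν3pos : ∀ y ∈ D, 0 < ν3 y)
    (βab : Fin 2 → Fin 2 → ℝ × ℝ → ℝ) (γ : Fin 2 → Fin 2 → Fin 2 → ℝ × ℝ → ℝ)
    (K : ℝ × ℝ → ℝ)
    (hβab : ∀ a b, ContinuousOn (βab a b) D)
    (hγ : ∀ c a b, ContinuousOn (γ c a b) D)
    (hK : ContinuousOn K D)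
    (g : ℝ) (hg : 0 < g) (C : ℝ)
    (mr mi : ℝ × ℝ × ℝ → ℝ) (hmr : ∀ p, mr p = 0) (hmi : ∀ p, mi p = 0)
    (h v1 v2 : ℝ × ℝ × ℝ → ℝ)
    (hh : h = fun p => (C - b3 (p.1, p.2.1)) / ν3 (p.1, p.2.1))
    (hv1 : v1 = fun _ => 0) (hv2 : v2 = fun _ => 0)
    (w : ℝ × ℝ × ℝ → ℝ)
    (hw : w = fun p => g * (b3 (p.1, p.2.1) + h p * ν3 (p.1, p.2.1)))
    (speed : ℝ × ℝ × ℝ → ℝ)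
    (hspeed : speed = fun p => Real.sqrt ((v1 p) ^ 2 + (v2 p) ^ 2)) :
    -- mass balance on D
    (∀ p : ℝ × ℝ × ℝ, (p.1, p.2.1) ∈ D →
      pdt (fun q => h q * β (q.1, q.2.1) * θ (q.1, q.2.1)) p
        + pd1 (fun q => h q * β (q.1, q.2.1) * θ (q.1, q.2.1) * v1 q) p
        + pd2 (fun q => h q * β (q.1, q.2.1) * θ (q.1, q.2.1) * v2 q) p
      = β (p.1, p.2.1) * (mr p - θ (p.1, p.2.1) * mi p)) ∧
    -- momentum balance, c = 1, on D
    (∀ p : ℝ × ℝ × ℝ, (p.1, p.2.1) ∈ D →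
      pdt (fun q => h q * θ (q.1, q.2.1) * β (q.1, q.2.1) * v1 q) p
        + pd1 (fun q => θ (q.1, q.2.1) * β (q.1, q.2.1) * h q * v1 q * v1 q) p
        + pd2 (fun q => θ (q.1, q.2.1) * β (q.1, q.2.1) * h q * v1 q * v2 q) p
        + h p * θ (p.1, p.2.1) * β (p.1, p.2.1) *
            (γ 0 0 0 (p.1, p.2.1) * v1 p * v1 p + γ 0 0 1 (p.1, p.2.1) * v1 p * v2 p
              + γ 0 1 0 (p.1, p.2.1) * v2 p * v1 p + γ 0 1 1 (p.1, p.2.1) * v2 p * v2 p)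
        + h p * β (p.1, p.2.1) * θ (p.1, p.2.1) *
            (βab 0 0 (p.1, p.2.1) * pd1 w p + βab 0 1 (p.1, p.2.1) * pd2 w p)
      = - (β (p.1, p.2.1) * K (p.1, p.2.1) * speed p * v1 p)) ∧
    -- momentum balance, c = 2, on D
    (∀ p : ℝ × ℝ × ℝ, (p.1, p.2.1) ∈ D →
      pdt (fun q => h q * θ (q.1, q.2.1) * β (q.1, q.2.1) * v2 q) p
        + pd1 (fun q => θ (q.1, q.2.1) * β (q.1, q.2.1) * h q * v2 q * v1 q) p
        + pd2 (fun q => θ (q.1, q.2.1) * β (q.1, q.2.1) * h q * v2 q * v2 q) p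
        + h p * θ (p.1, p.2.1) * β (p.1, p.2.1) *
            (γ 1 0 0 (p.1, p.2.1) * v1 p * v1 p + γ 1 0 1 (p.1, p.2.1) * v1 p * v2 p
              + γ 1 1 0 (p.1, p.2.1) * v2 p * v1 p + γ 1 1 1 (p.1, p.2.1) * v2 p * v2 p)
        + h p * β (p.1, p.2.1) * θ (p.1, p.2.1) *
            (βab 1 0 (p.1, p.2.1) * pd1 w p + βab 1 1 (p.1, p.2.1) * pd2 w p)
      = - (β (p.1, p.2.1) * K (p.1, p.2.1) * speed p * v2 p)) := by
  have hwd : ∀ p : ℝ × ℝ × ℝ, (p.1, p.2.1) ∈ D → fderiv ℝ w p = 0 := by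
    intro p hp
    have hcont : Continuous (fun q : ℝ × ℝ × ℝ => (q.1, q.2.1)) := by fun_prop
    have hnear : ∀ᶠ q : ℝ × ℝ × ℝ in nhds p, (q.1, q.2.1) ∈ D :=
      hcont.continuousAt.eventually_mem (hD.mem_nhds hp)
    have heq : w =ᶠ[nhds p] fun _ => g * C := by
      filter_upwards [hnear] with q hq
      have hne := (hν3pos _ hq).ne'
      simp only [hw, hh]
      rw [div_mul_cancel₀ _ hne]
      ring
    rw [heq.fderiv_eq]
    simp
  have hmass : ∀ p : ℝ × ℝ × ℝ,
      pdt (fun q => h q * β (q.1, q.2.1) * θ (q.1, q.2.1)) p = 0 := by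
    intro p
    rw [hh]
    exact pdt_of_space (fun y => (C - b3 y) / ν3 y * β y * θ y) p
  refine ⟨fun p hp => ?_, fun p hp => ?_, fun p hp => ?_⟩
  · rw [hmass p]
    simp [hv1, hv2, hmr, hmi, pd1, pd2]
  · simp [hv1, hv2, pd1, pd2, pdt, hwd p hp]
  · simp [hv1, hv2, pd1, pd2, pdt, hwd p hp]
end

section
/- Let θ, z : ℝ² → ℝ be continuously differentiable with θ > 0, let g > 0, α_p, α_s ∈ ℝ, and let h, v¹, v², M : ℝ² × ℝ → ℝ be continuously differentiable with h > 0. If (h, v¹, v²) satisfies the simplified shallow-water system with vegetation with mass source M, then the energy identity holds: ∂_t(θhℰ) + ∂₁(θhv¹(ℰ + gh/2)) + ∂₂(θhv²(ℰ + gh/2)) = M(−|v|²/2 + w) − 𝒦(h,θ)|v|³, where ℰ := |v|²/2 + g(z + h/2). -/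
/-- solutions of the simplified shallow-water system with vegetation
satisfy the energy identity
`∂_t(θhℰ) + ∂₁(θhv¹(ℰ + gh/2)) + ∂₂(θhv²(ℰ + gh/2)) = M(−|v|²/2 + w) − 𝒦(h,θ)|v|³`,
where `ℰ = |v|²/2 + g(z + h/2)`, `w = g(z+h)` and `𝒦(h,θ) = α_p h(1−θ) + α_s θ`. -/
theorem energy_identity_simplified_swe
    (θ z : ℝ × ℝ → ℝ) (hθ : ContDiff ℝ 1 θ) (hz : ContDiff ℝ 1 z)
    (hθpos : ∀ y, 0 < θ y)
    (g αp αs : ℝ) (hg : 0 < g)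
    (h v1 v2 M : ℝ × ℝ × ℝ → ℝ)
    (hhC : ContDiff ℝ 1 h) (hv1C : ContDiff ℝ 1 v1) (hv2C : ContDiff ℝ 1 v2)
    (hMC : ContDiff ℝ 1 M)
    (hhpos : ∀ p, 0 < h p)
    (w : ℝ × ℝ × ℝ → ℝ) (hw : w = fun p => g * (z (p.1, p.2.1) + h p))
    (K : ℝ × ℝ × ℝ → ℝ)
    (hK : K = fun p => αp * h p * (1 - θ (p.1, p.2.1)) + αs * θ (p.1, p.2.1))
    (speed : ℝ × ℝ × ℝ → ℝ)
    (hspeed : speed = fun p => Real.sqrt ((v1 p) ^ 2 + (v2 p) ^ 2))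
    (E : ℝ × ℝ × ℝ → ℝ)
    (hE : E = fun p => ((v1 p) ^ 2 + (v2 p) ^ 2) / 2
      + g * (z (p.1, p.2.1) + h p / 2))
    -- mass balance
    (mass : ∀ p : ℝ × ℝ × ℝ,
      pdt (fun q => θ (q.1, q.2.1) * h q) p
        + pd1 (fun q => θ (q.1, q.2.1) * h q * v1 q) p
        + pd2 (fun q => θ (q.1, q.2.1) * h q * v2 q) p = M p)
    -- momentum balance, a = 1
    (mom1 : ∀ p : ℝ × ℝ × ℝ,
      pdt (fun q => θ (q.1, q.2.1) * h q * v1 q) p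
        + pd1 (fun q => θ (q.1, q.2.1) * h q * v1 q * v1 q) p
        + pd2 (fun q => θ (q.1, q.2.1) * h q * v1 q * v2 q) p
        + θ (p.1, p.2.1) * h p * pd1 w p
      = - (K p * speed p * v1 p))
    -- momentum balance, a = 2
    (mom2 : ∀ p : ℝ × ℝ × ℝ,
      pdt (fun q => θ (q.1, q.2.1) * h q * v2 q) p
        + pd1 (fun q => θ (q.1, q.2.1) * h q * v2 q * v1 q) p
        + pd2 (fun q => θ (q.1, q.2.1) * h q * v2 q * v2 q) p
        + θ (p.1, p.2.1) * h p * pd2 w p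
      = - (K p * speed p * v2 p)) :
    ∀ p : ℝ × ℝ × ℝ,
      pdt (fun q => θ (q.1, q.2.1) * h q * E q) p
        + pd1 (fun q => θ (q.1, q.2.1) * h q * v1 q * (E q + g * h q / 2)) p
        + pd2 (fun q => θ (q.1, q.2.1) * h q * v2 q * (E q + g * h q / 2)) p
      = M p * (-(((v1 p) ^ 2 + (v2 p) ^ 2) / 2) + w p) - K p * (speed p) ^ 3 := by
  intro p
  have mass := mass p
  have mom1 := mom1 p
  have mom2 := mom2 p
  have hs : speed p ^ 2 = v1 p ^ 2 + v2 p ^ 2 := by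
    rw [hspeed]
    exact Real.sq_sqrt (by positivity)
  have hwp : w p = g * (z (p.1, p.2.1) + h p) := by rw [hw]
  rw [hwp]
  rw [hw] at mom1 mom2
  subst hE
  clear hK hspeed hwp
  have dh : DifferentiableAt ℝ h p := (hhC.differentiable (by norm_num)) p
  have d1 : DifferentiableAt ℝ v1 p := (hv1C.differentiable (by norm_num)) p
  have d2 : DifferentiableAt ℝ v2 p := (hv2C.differentiable (by norm_num)) p
  have key : ∀ f : ℝ × ℝ → ℝ, ContDiff ℝ 1 f →
      DifferentiableAt ℝ (fun q : ℝ × ℝ × ℝ => f (q.1, q.2.1)) p ∧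
      fderiv ℝ (fun q : ℝ × ℝ × ℝ => f (q.1, q.2.1)) p (0, 0, 1) = 0 := by
    intro f hf
    have hf' : HasFDerivAt f (fderiv ℝ f (p.1, p.2.1)) (p.1, p.2.1) :=
      ((hf.differentiable (by norm_num)) _).hasFDerivAt
    let L : ℝ × ℝ × ℝ →L[ℝ] ℝ × ℝ :=
      (ContinuousLinearMap.fst ℝ ℝ (ℝ × ℝ)).prod
        ((ContinuousLinearMap.fst ℝ ℝ ℝ).comp (ContinuousLinearMap.snd ℝ ℝ (ℝ × ℝ)))
    have hc : HasFDerivAt (fun q : ℝ × ℝ × ℝ => f (q.1, q.2.1))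
        ((fderiv ℝ f (p.1, p.2.1)).comp L) p :=
      HasFDerivAt.comp (g := f) (f := L) p hf' L.hasFDerivAt
    refine ⟨hc.differentiableAt, ?_⟩
    rw [hc.fderiv]
    have : L (0, 0, 1) = 0 := rfl
    rw [ContinuousLinearMap.comp_apply, this, map_zero]
  obtain ⟨dT, hT⟩ := key θ hθ
  obtain ⟨dZ, hZ⟩ := key z hz
  have eT : θ (p.1, p.2.1) = (fun q : ℝ × ℝ × ℝ => θ (q.1, q.2.1)) p := rfl
  have eZ : z (p.1, p.2.1) = (fun q : ℝ × ℝ × ℝ => z (q.1, q.2.1)) p := rfl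
  rw [eZ]
  rw [eT] at mom1 mom2
  clear key eT eZ
  have gen : ∀ (T Z : ℝ × ℝ × ℝ → ℝ), DifferentiableAt ℝ T p → DifferentiableAt ℝ Z p →
      fderiv ℝ T p (0, 0, 1) = 0 → fderiv ℝ Z p (0, 0, 1) = 0 →
      pdt (fun q => T q * h q) p + pd1 (fun q => T q * h q * v1 q) p
        + pd2 (fun q => T q * h q * v2 q) p = M p →
      pdt (fun q => T q * h q * v1 q) p + pd1 (fun q => T q * h q * v1 q * v1 q) p
        + pd2 (fun q => T q * h q * v1 q * v2 q) p
        + T p * h p * pd1 (fun q => g * (Z q + h q)) p = - (K p * speed p * v1 p) →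
      pdt (fun q => T q * h q * v2 q) p + pd1 (fun q => T q * h q * v2 q * v1 q) p
        + pd2 (fun q => T q * h q * v2 q * v2 q) p
        + T p * h p * pd2 (fun q => g * (Z q + h q)) p = - (K p * speed p * v2 p) →
      pdt (fun q => T q * h q * ((v1 q ^ 2 + v2 q ^ 2) / 2 + g * (Z q + h q / 2))) p
        + pd1 (fun q => T q * h q * v1 q *
            ((v1 q ^ 2 + v2 q ^ 2) / 2 + g * (Z q + h q / 2) + g * h q / 2)) p
        + pd2 (fun q => T q * h q * v2 q *
            ((v1 q ^ 2 + v2 q ^ 2) / 2 + g * (Z q + h q / 2) + g * h q / 2)) p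
      = M p * (-((v1 p ^ 2 + v2 p ^ 2) / 2) + g * (Z p + h p)) - K p * speed p ^ 3 := by
    intro T Z dT dZ hT hZ mass mom1 mom2
    simp only [pdt, pd1, pd2, div_eq_mul_inv, pow_two] at mass mom1 mom2 ⊢
    simp (disch := fun_prop) only [fderiv_fun_mul, fderiv_fun_add, fderiv_fun_const,
      ContinuousLinearMap.add_apply, ContinuousLinearMap.smul_apply, smul_eq_mul,
      Pi.zero_apply, ContinuousLinearMap.zero_apply, hT, hZ] at mass mom1 mom2 ⊢
    linear_combination v1 p * mom1 + v2 p * mom2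
      + (g * (Z p + h p) - (v1 p ^ 2 + v2 p ^ 2) / 2) * mass + K p * speed p * hs
  exact gen _ _ dT dZ hT hZ mass mom1 mom2
end

section
/- Let θ, z : ℝ² → ℝ be continuously differentiable with θ > 0, let g > 0, and let h, v¹, v² : ℝ² → ℝ be continuously differentiable time-independent functions with h > 0 that satisfy the steady simplified shallow-water system with zero mass source and zero friction: ∂₁(θhv¹) + ∂₂(θhv²) = 0 and, for a = 1,2, ∂₁(θhv^a v¹) + ∂₂(θhv^a v²) + θh ∂_a w = 0, where w = g(z+h). Then Bernoulli's law holds: the total energy ℰᵗ := |v|²/2 + g z + g h satisfies v¹ ∂₁ℰᵗ + v² ∂₂ℰᵗ = 0 everywhere, i.e. ℰᵗ is constant along each current line. -/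
/-- Partial derivative with respect to the first variable `y¹` on the plane. -/
noncomputable def qd1 (f : ℝ × ℝ → ℝ) (y : ℝ × ℝ) : ℝ :=
  fderiv ℝ f y (1, 0)

/-- Partial derivative with respect to the second variable `y²` on the plane. -/
noncomputable def qd2 (f : ℝ × ℝ → ℝ) (y : ℝ × ℝ) : ℝ :=
  fderiv ℝ f y (0, 1)

/-- Bernoulli's law for the simplified shallow-water system with vegetation.
At a steady state with zero mass source and zero friction, the total energy
`ℰᵗ = |v|²/2 + gz + gh` is constant along each current line: `v¹∂₁ℰᵗ + v²∂₂ℰᵗ = 0`. -/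
theorem bernoulli_law_simplified_swe
    (θ z : ℝ × ℝ → ℝ) (hθ : ContDiff ℝ 1 θ) (hz : ContDiff ℝ 1 z)
    (hθpos : ∀ y, 0 < θ y)
    (g : ℝ) (hg : 0 < g)
    (h v1 v2 : ℝ × ℝ → ℝ)
    (hhC : ContDiff ℝ 1 h) (hv1C : ContDiff ℝ 1 v1) (hv2C : ContDiff ℝ 1 v2)
    (hhpos : ∀ y, 0 < h y)
    (w : ℝ × ℝ → ℝ) (hw : w = fun y => g * (z y + h y))
    -- steady mass balance with zero mass source
    (mass : ∀ y : ℝ × ℝ,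
      qd1 (fun x => θ x * h x * v1 x) y + qd2 (fun x => θ x * h x * v2 x) y = 0)
    -- steady momentum balance with zero friction, a = 1
    (mom1 : ∀ y : ℝ × ℝ,
      qd1 (fun x => θ x * h x * v1 x * v1 x) y
        + qd2 (fun x => θ x * h x * v1 x * v2 x) y
        + θ y * h y * qd1 w y = 0)
    -- steady momentum balance with zero friction, a = 2
    (mom2 : ∀ y : ℝ × ℝ,
      qd1 (fun x => θ x * h x * v2 x * v1 x) y
        + qd2 (fun x => θ x * h x * v2 x * v2 x) y
        + θ y * h y * qd2 w y = 0)
    (Et : ℝ × ℝ → ℝ)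
    (hEt : Et = fun y => ((v1 y) ^ 2 + (v2 y) ^ 2) / 2 + g * z y + g * h y) :
    ∀ y : ℝ × ℝ, v1 y * qd1 Et y + v2 y * qd2 Et y = 0 := by
  intro y
  subst hw hEt
  have dθ := (hθ.differentiable one_ne_zero y).hasFDerivAt
  have dz := (hz.differentiable one_ne_zero y).hasFDerivAt
  have dh := (hhC.differentiable one_ne_zero y).hasFDerivAt
  have d1 := (hv1C.differentiable one_ne_zero y).hasFDerivAt
  have d2 := (hv2C.differentiable one_ne_zero y).hasFDerivAt
  have m := mass y
  have m1 := mom1 y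
  have m2 := mom2 y
  have dw : HasFDerivAt (fun y => g * (z y + h y)) _ y := (dz.add dh).const_mul g
  have q1 : HasFDerivAt (fun x => θ x * h x * v1 x) _ y := (dθ.mul dh).mul d1
  have q2 : HasFDerivAt (fun x => θ x * h x * v2 x) _ y := (dθ.mul dh).mul d2
  have q11 : HasFDerivAt (fun x => θ x * h x * v1 x * v1 x) _ y := q1.mul d1
  have q12 : HasFDerivAt (fun x => θ x * h x * v1 x * v2 x) _ y := q1.mul d2
  have q21 : HasFDerivAt (fun x => θ x * h x * v2 x * v1 x) _ y := q2.mul d1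
  have q22 : HasFDerivAt (fun x => θ x * h x * v2 x * v2 x) _ y := q2.mul d2
  have dE : HasFDerivAt
      (fun y => ((v1 y) ^ 2 + (v2 y) ^ 2) / 2 + g * z y + g * h y) _ y :=
    ((((d1.pow 2).add (d2.pow 2)).mul_const (2 : ℝ)⁻¹).add (dz.const_mul g)).add
      (dh.const_mul g)
  unfold qd1 qd2 at *
  rw [q1.fderiv, q2.fderiv] at m
  rw [q11.fderiv, q12.fderiv, dw.fderiv] at m1
  rw [q21.fderiv, q22.fderiv, dw.fderiv] at m2
  rw [dE.fderiv]
  simp at m m1 m2 ⊢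
  have hne : θ y * h y ≠ 0 := (mul_pos (hθpos y) (hhpos y)).ne'
  apply mul_left_cancel₀ hne
  linear_combination v1 y * m1 + v2 y * m2 - (v1 y ^ 2 + v2 y ^ 2) * m
end

section
/- Let Ω = [a₁,b₁] × [a₂,b₂] ⊂ ℝ² be a closed rectangle, let θ, z : ℝ² → ℝ be smooth with 0 < θ ≤ 1 and z ≥ 0, let g > 0, α_p ≥ 0, α_s > 0, and let h, v¹, v² : ℝ² × ℝ → ℝ be smooth with h > 0, satisfying the simplified shallow-water system with vegetation with zero mass source (M = 0). Fix a time t and assume the outward-flux boundary conditions at time t: v¹(a₁,·,t) ≤ 0, v¹(b₁,·,t) ≥ 0, v²(·,a₂,t) ≤ 0, v²(·,b₂,t) ≥ 0, and assume there is a point of Ω at which (v¹,v²)(·,t) ≠ (0,0). Then the total energy of Ω is strictly decreasing at time t: d/dt ∫_Ω θ h ℰ dy¹dy² < 0, where ℰ := |v|²/2 + g(z + h/2). -/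
open MeasureTheory

lemma dmul {f g : ℝ × ℝ × ℝ → ℝ} {p u : ℝ × ℝ × ℝ} (hf : Differentiable ℝ f)
    (hg : Differentiable ℝ g) :
    fderiv ℝ (fun q => f q * g q) p u = f p * fderiv ℝ g p u + g p * fderiv ℝ f p u := by
  rw [fderiv_fun_mul (hf p) (hg p)]; simp

lemma dadd {f g : ℝ × ℝ × ℝ → ℝ} {p u : ℝ × ℝ × ℝ} (hf : Differentiable ℝ f)
    (hg : Differentiable ℝ g) :
    fderiv ℝ (fun q => f q + g q) p u = fderiv ℝ f p u + fderiv ℝ g p u := by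
  rw [fderiv_fun_add (hf p) (hg p)]; simp

lemma dconst {p u : ℝ × ℝ × ℝ} (c : ℝ) :
    fderiv ℝ (fun _ : ℝ × ℝ × ℝ => c) p u = 0 := by
  simp

lemma dproj {θ : ℝ × ℝ → ℝ} (hθ : Differentiable ℝ θ) (p : ℝ × ℝ × ℝ) :
    fderiv ℝ (fun q : ℝ × ℝ × ℝ => θ (q.1, q.2.1)) p (0, 0, 1) = 0 := by
  have h1 : HasFDerivAt (fun q : ℝ × ℝ × ℝ => (q.1, q.2.1))
      ((ContinuousLinearMap.fst ℝ ℝ (ℝ × ℝ)).prod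
        ((ContinuousLinearMap.fst ℝ ℝ ℝ).comp (ContinuousLinearMap.snd ℝ ℝ (ℝ × ℝ)))) p :=
    ((ContinuousLinearMap.fst ℝ ℝ (ℝ × ℝ)).prod
        ((ContinuousLinearMap.fst ℝ ℝ ℝ).comp
          (ContinuousLinearMap.snd ℝ ℝ (ℝ × ℝ)))).hasFDerivAt
  have h2 := (hθ (p.1, p.2.1)).hasFDerivAt.comp p h1
  have h3 : fderiv ℝ (fun q : ℝ × ℝ × ℝ => θ (q.1, q.2.1)) p = _ := h2.fderiv
  rw [h3]
  simp only [ContinuousLinearMap.comp_apply, ContinuousLinearMap.prod_apply,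
    ContinuousLinearMap.coe_fst', ContinuousLinearMap.coe_snd']
  exact map_zero _

lemma pointwise (g : ℝ) (T Z h v1 v2 w : ℝ × ℝ × ℝ → ℝ) (R1 R2 : ℝ) (p : ℝ × ℝ × ℝ)
    (hT : Differentiable ℝ T) (hZ : Differentiable ℝ Z) (hh : Differentiable ℝ h)
    (h1 : Differentiable ℝ v1) (h2 : Differentiable ℝ v2)
    (hw : w = fun p => g * (Z p + h p))
    (hT0 : fderiv ℝ T p (0, 0, 1) = 0) (hZ0 : fderiv ℝ Z p (0, 0, 1) = 0)
    (mass : pdt (fun q => T q * h q) p + pd1 (fun q => T q * h q * v1 q) p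
        + pd2 (fun q => T q * h q * v2 q) p = 0)
    (mom1 : pdt (fun q => T q * h q * v1 q) p + pd1 (fun q => T q * h q * v1 q * v1 q) p
        + pd2 (fun q => T q * h q * v1 q * v2 q) p + T p * h p * pd1 w p = R1)
    (mom2 : pdt (fun q => T q * h q * v2 q) p + pd1 (fun q => T q * h q * v2 q * v1 q) p
        + pd2 (fun q => T q * h q * v2 q * v2 q) p + T p * h p * pd2 w p = R2) :
    pdt (fun q => T q * h q * (2⁻¹ * (v1 q * v1 q + v2 q * v2 q) + g * (Z q + 2⁻¹ * h q))) p
      + pd1 (fun q => T q * h q * v1 q * (2⁻¹ * (v1 q * v1 q + v2 q * v2 q) + g * (Z q + h q))) p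
      + pd2 (fun q => T q * h q * v2 q * (2⁻¹ * (v1 q * v1 q + v2 q * v2 q) + g * (Z q + h q))) p
      = v1 p * R1 + v2 p * R2 := by
  subst hw
  unfold pdt pd1 pd2 at *
  simp (disch := fun_prop) only [dmul, dadd, dconst, hT0, hZ0] at *
  linear_combination v1 p * mom1 + v2 p * mom2 +
    (g * (Z p + h p) - 2⁻¹ * (v1 p * v1 p + v2 p * v2 p)) * mass

lemma deriv_under (S : Set (ℝ × ℝ)) (hS : IsCompact S) (G : ℝ × ℝ × ℝ → ℝ)
    (hG : ContDiff ℝ (⊤ : ℕ∞) G) (t : ℝ) :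
    deriv (fun s => ∫ y in S, G (y.1, y.2, s)) t = ∫ y in S, pdt G (y.1, y.2, t) := by
  have hc : Continuous (pdt G) := by
    unfold pdt
    exact (hG.continuous_fderiv (by simp)).clm_apply continuous_const
  have hGc := hG.continuous
  have hK : IsCompact (S ×ˢ Metric.closedBall t 1) := hS.prod (isCompact_closedBall t 1)
  obtain ⟨C, hC⟩ := hK.exists_bound_of_continuousOn
    (f := fun q : (ℝ × ℝ) × ℝ => pdt G (q.1.1, q.1.2, q.2)) (by fun_prop)
  have hm : MeasurableSet S := hS.measurableSet
  have := (hasDerivAt_integral_of_dominated_loc_of_deriv_le (μ := volume.restrict S)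
    (F := fun s (y : ℝ × ℝ) => G (y.1, y.2, s)) (F' := fun s y => pdt G (y.1, y.2, s))
    (x₀ := t) (s := Metric.ball t 1) (bound := fun _ => C)
    (Metric.ball_mem_nhds t one_pos) ?_ ?_ ?_ ?_ ?_ ?_).2
  · exact this.deriv
  · exact Filter.Eventually.of_forall fun s =>
      (by fun_prop : Continuous fun y : ℝ × ℝ => G (y.1, y.2, s)).aestronglyMeasurable
  · exact (by fun_prop : Continuous fun y : ℝ × ℝ => G (y.1, y.2, t)).continuousOn.integrableOn_compact hS
  · exact (by fun_prop : Continuous fun y : ℝ × ℝ => pdt G (y.1, y.2, t)).aestronglyMeasurable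
  · refine (ae_restrict_iff' hm).2 (Filter.Eventually.of_forall fun y hy s hs => ?_)
    exact hC (y, s) ⟨hy, Metric.ball_subset_closedBall hs⟩
  · exact (continuousOn_const (c := C)).integrableOn_compact hS
  · refine Filter.Eventually.of_forall fun y s hs => ?_
    have h1 : HasDerivAt (fun s : ℝ => (y.1, y.2, s)) ((0 : ℝ), (0 : ℝ), (1 : ℝ)) s :=
      (hasDerivAt_const s y.1).prodMk ((hasDerivAt_const s y.2).prodMk (hasDerivAt_id s))
    exact ((hG.differentiable (by simp)) (y.1, y.2, s)).hasFDerivAt.comp_hasDerivAt s h1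

lemma div_thm (a1 b1 a2 b2 t : ℝ) (hab1 : a1 < b1) (hab2 : a2 < b2)
    (F1 F2 : ℝ × ℝ × ℝ → ℝ) (h1 : ContDiff ℝ (⊤ : ℕ∞) F1) (h2 : ContDiff ℝ (⊤ : ℕ∞) F2)
    (bcL : ∀ y2 ∈ Set.Icc a2 b2, F1 (a1, y2, t) ≤ 0)
    (bcR : ∀ y2 ∈ Set.Icc a2 b2, 0 ≤ F1 (b1, y2, t))
    (bcB : ∀ y1 ∈ Set.Icc a1 b1, F2 (y1, a2, t) ≤ 0)
    (bcT : ∀ y1 ∈ Set.Icc a1 b1, 0 ≤ F2 (y1, b2, t)) :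
    0 ≤ ∫ y in Set.Icc a1 b1 ×ˢ Set.Icc a2 b2, pd1 F1 (y.1, y.2, t) + pd2 F2 (y.1, y.2, t) := by
  have hc1 : Continuous (pd1 F1) := by
    unfold pd1
    exact (h1.continuous_fderiv (by simp)).clm_apply continuous_const
  have hc2 : Continuous (pd2 F2) := by
    unfold pd2
    exact (h2.continuous_fderiv (by simp)).clm_apply continuous_const
  let L : ℝ × ℝ →L[ℝ] ℝ × ℝ × ℝ := (ContinuousLinearMap.fst ℝ ℝ ℝ).prod
    ((ContinuousLinearMap.snd ℝ ℝ ℝ).prod 0)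
  have hL : ∀ y : ℝ × ℝ, HasFDerivAt (fun y : ℝ × ℝ => (y.1, y.2, t)) L y := fun y =>
    (ContinuousLinearMap.fst ℝ ℝ ℝ).hasFDerivAt.prodMk
      ((ContinuousLinearMap.snd ℝ ℝ ℝ).hasFDerivAt.prodMk (hasFDerivAt_const t y))
  have hF : ∀ F : ℝ × ℝ × ℝ → ℝ, ContDiff ℝ (⊤ : ℕ∞) F → ∀ y : ℝ × ℝ,
      HasFDerivAt (fun y : ℝ × ℝ => F (y.1, y.2, t)) ((fderiv ℝ F (y.1, y.2, t)).comp L) y :=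
    fun F hF y => ((hF.differentiable (by simp)) (y.1, y.2, t)).hasFDerivAt.comp y (hL y)
  have hF1c := h1.continuous
  have hF2c := h2.continuous
  have key := integral_divergence_prod_Icc_of_hasFDerivAt_of_le
    (fun y : ℝ × ℝ => F1 (y.1, y.2, t)) (fun y : ℝ × ℝ => F2 (y.1, y.2, t))
    (fun y => (fderiv ℝ F1 (y.1, y.2, t)).comp L) (fun y => (fderiv ℝ F2 (y.1, y.2, t)).comp L)
    (a1, a2) (b1, b2) ⟨hab1.le, hab2.le⟩ (by fun_prop) (by fun_prop)
    (fun y _ => hF F1 h1 y) (fun y _ => hF F2 h2 y)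
    ((by simpa [L, pd1, pd2] using (by fun_prop :
      Continuous fun y : ℝ × ℝ => pd1 F1 (y.1, y.2, t) + pd2 F2 (y.1, y.2, t)) :
      Continuous fun y : ℝ × ℝ => (fderiv ℝ F1 (y.1, y.2, t)).comp L (1, 0) +
        (fderiv ℝ F2 (y.1, y.2, t)).comp L (0, 1)).continuousOn.integrableOn_compact isCompact_Icc)
  have e : (∫ y in Set.Icc a1 b1 ×ˢ Set.Icc a2 b2,
      pd1 F1 (y.1, y.2, t) + pd2 F2 (y.1, y.2, t)) =
      (((∫ x in a1..b1, F2 (x, b2, t)) - ∫ x in a1..b1, F2 (x, a2, t)) +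
          ∫ y in a2..b2, F1 (b1, y, t)) - ∫ y in a2..b2, F1 (a1, y, t) := by
    rw [Set.Icc_prod_Icc]
    simpa [L, pd1, pd2] using key
  rw [e]
  have i1 : (∫ x in a1..b1, F2 (x, a2, t)) ≤ 0 := by
    have := intervalIntegral.integral_nonneg (μ := volume) (f := fun x => - F2 (x, a2, t)) hab1.le
      (fun x hx => by simpa using bcB x hx)
    simpa using this
  have i2 : (∫ x in a2..b2, F1 (a1, x, t)) ≤ 0 := by
    have := intervalIntegral.integral_nonneg (μ := volume) (f := fun x => - F1 (a1, x, t)) hab2.le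
      (fun x hx => by simpa using bcL x hx)
    simpa using this
  have i3 := intervalIntegral.integral_nonneg (μ := volume) (f := fun x => F2 (x, b2, t)) hab1.le bcT
  have i4 := intervalIntegral.integral_nonneg (μ := volume) (f := fun x => F1 (b1, x, t)) hab2.le bcR
  linarith

lemma pos_int (a1 b1 a2 b2 : ℝ) (hab1 : a1 < b1) (hab2 : a2 < b2)
    (f : ℝ × ℝ → ℝ) (hf : Continuous f) (h0 : ∀ y, 0 ≤ f y)
    (hex : ∃ y ∈ Set.Icc a1 b1 ×ˢ Set.Icc a2 b2, 0 < f y) :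
    0 < ∫ y in Set.Icc a1 b1 ×ˢ Set.Icc a2 b2, f y := by
  have hS : IsCompact (Set.Icc a1 b1 ×ˢ Set.Icc a2 b2) := isCompact_Icc.prod isCompact_Icc
  rw [setIntegral_pos_iff_support_of_nonneg_ae (Filter.Eventually.of_forall h0)
    (hf.continuousOn.integrableOn_compact hS)]
  obtain ⟨y, hy, hfy⟩ := hex
  have ho : IsOpen {y | 0 < f y} := isOpen_lt continuous_const hf
  have hcl : y ∈ closure (Set.Ioo a1 b1 ×ˢ Set.Ioo a2 b2) := by
    rw [closure_prod_eq, closure_Ioo hab1.ne, closure_Ioo hab2.ne]; exact hy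
  have hne := mem_closure_iff.1 hcl _ ho hfy
  refine lt_of_lt_of_le ((ho.inter (isOpen_Ioo.prod isOpen_Ioo)).measure_pos volume hne) ?_
  refine measure_mono ?_
  rintro x ⟨hx, hx1, hx2⟩
  exact ⟨ne_of_gt hx, Set.Ioo_subset_Icc_self hx1, Set.Ioo_subset_Icc_self hx2⟩

/-- energy dissipation for the simplified shallow-water system with
vegetation on a rectangle `Ω = [a₁,b₁] × [a₂,b₂]`.  With no mass production and
outward-flux boundary conditions at time `t`, and with a point of `Ω` where the
velocity does not vanish at time `t`, the total energy `∫_Ω θhℰ` is strictly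
decreasing at time `t`. -/
theorem energy_dissipation_simplified_swe
    (a1 b1 a2 b2 : ℝ) (hab1 : a1 < b1) (hab2 : a2 < b2)
    (θ z : ℝ × ℝ → ℝ) (hθ : ContDiff ℝ (⊤ : ℕ∞) θ) (hz : ContDiff ℝ (⊤ : ℕ∞) z)
    (hθpos : ∀ y, 0 < θ y) (hθle : ∀ y, θ y ≤ 1) (hznn : ∀ y, 0 ≤ z y)
    (g αp αs : ℝ) (hg : 0 < g) (hαp : 0 ≤ αp) (hαs : 0 < αs)
    (h v1 v2 : ℝ × ℝ × ℝ → ℝ)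
    (hhC : ContDiff ℝ (⊤ : ℕ∞) h) (hv1C : ContDiff ℝ (⊤ : ℕ∞) v1) (hv2C : ContDiff ℝ (⊤ : ℕ∞) v2)
    (hhpos : ∀ p, 0 < h p)
    (w : ℝ × ℝ × ℝ → ℝ) (hw : w = fun p => g * (z (p.1, p.2.1) + h p))
    (K : ℝ × ℝ × ℝ → ℝ)
    (hK : K = fun p => αp * h p * (1 - θ (p.1, p.2.1)) + αs * θ (p.1, p.2.1))
    (speed : ℝ × ℝ × ℝ → ℝ)
    (hspeed : speed = fun p => Real.sqrt ((v1 p) ^ 2 + (v2 p) ^ 2))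
    (E : ℝ × ℝ × ℝ → ℝ)
    (hE : E = fun p => ((v1 p) ^ 2 + (v2 p) ^ 2) / 2
      + g * (z (p.1, p.2.1) + h p / 2))
    -- mass balance with zero mass source
    (mass : ∀ p : ℝ × ℝ × ℝ,
      pdt (fun q => θ (q.1, q.2.1) * h q) p
        + pd1 (fun q => θ (q.1, q.2.1) * h q * v1 q) p
        + pd2 (fun q => θ (q.1, q.2.1) * h q * v2 q) p = 0)
    -- momentum balance, a = 1
    (mom1 : ∀ p : ℝ × ℝ × ℝ,
      pdt (fun q => θ (q.1, q.2.1) * h q * v1 q) p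
        + pd1 (fun q => θ (q.1, q.2.1) * h q * v1 q * v1 q) p
        + pd2 (fun q => θ (q.1, q.2.1) * h q * v1 q * v2 q) p
        + θ (p.1, p.2.1) * h p * pd1 w p
      = - (K p * speed p * v1 p))
    -- momentum balance, a = 2
    (mom2 : ∀ p : ℝ × ℝ × ℝ,
      pdt (fun q => θ (q.1, q.2.1) * h q * v2 q) p
        + pd1 (fun q => θ (q.1, q.2.1) * h q * v2 q * v1 q) p
        + pd2 (fun q => θ (q.1, q.2.1) * h q * v2 q * v2 q) p
        + θ (p.1, p.2.1) * h p * pd2 w p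
      = - (K p * speed p * v2 p))
    (t : ℝ)
    -- outward-flux boundary conditions at time t
    (bcL : ∀ y2 ∈ Set.Icc a2 b2, v1 (a1, y2, t) ≤ 0)
    (bcR : ∀ y2 ∈ Set.Icc a2 b2, 0 ≤ v1 (b1, y2, t))
    (bcB : ∀ y1 ∈ Set.Icc a1 b1, v2 (y1, a2, t) ≤ 0)
    (bcT : ∀ y1 ∈ Set.Icc a1 b1, 0 ≤ v2 (y1, b2, t))
    -- the velocity is not identically zero on Ω at time t
    (hex : ∃ y ∈ Set.Icc a1 b1 ×ˢ Set.Icc a2 b2,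
      v1 (y.1, y.2, t) ≠ 0 ∨ v2 (y.1, y.2, t) ≠ 0) :
    deriv (fun s => ∫ y in Set.Icc a1 b1 ×ˢ Set.Icc a2 b2,
      θ y * h (y.1, y.2, s) * E (y.1, y.2, s)) t < 0 := by
  set T : ℝ × ℝ × ℝ → ℝ := fun q => θ (q.1, q.2.1) with hTdef
  set Z : ℝ × ℝ × ℝ → ℝ := fun q => z (q.1, q.2.1) with hZdef
  have hTC : ContDiff ℝ (⊤ : ℕ∞) T := by fun_prop
  have hZC : ContDiff ℝ (⊤ : ℕ∞) Z := by fun_prop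
  have hTc := hTC.continuous
  have hhc := hhC.continuous
  have hv1c := hv1C.continuous
  have hv2c := hv2C.continuous
  set G : ℝ × ℝ × ℝ → ℝ := fun q =>
    T q * h q * (2⁻¹ * (v1 q * v1 q + v2 q * v2 q) + g * (Z q + 2⁻¹ * h q)) with hGdef
  set F1 : ℝ × ℝ × ℝ → ℝ := fun q =>
    T q * h q * v1 q * (2⁻¹ * (v1 q * v1 q + v2 q * v2 q) + g * (Z q + h q)) with hF1def
  set F2 : ℝ × ℝ × ℝ → ℝ := fun q =>
    T q * h q * v2 q * (2⁻¹ * (v1 q * v1 q + v2 q * v2 q) + g * (Z q + h q)) with hF2def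
  have hGC : ContDiff ℝ (⊤ : ℕ∞) G := by fun_prop
  have hF1C : ContDiff ℝ (⊤ : ℕ∞) F1 := by fun_prop
  have hF2C : ContDiff ℝ (⊤ : ℕ∞) F2 := by fun_prop
  have hKc : Continuous K := by rw [hK]; fun_prop
  have hsc : Continuous speed := by rw [hspeed]; fun_prop
  have hKpos : ∀ p, 0 < K p := by
    intro p
    have h1 := hθpos (p.1, p.2.1)
    have h2 := sub_nonneg.2 (hθle (p.1, p.2.1))
    have h3 := hhpos p
    rw [hK]
    show 0 < αp * h p * (1 - θ (p.1, p.2.1)) + αs * θ (p.1, p.2.1)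
    positivity
  have hs0 : ∀ p, 0 ≤ speed p := by
    intro p; rw [hspeed]; exact Real.sqrt_nonneg _
  set D : ℝ × ℝ × ℝ → ℝ := fun p => K p * speed p * (v1 p ^ 2 + v2 p ^ 2) with hDdef
  have hDc : Continuous D := by fun_prop
  have hpt : ∀ p, pdt G p = - D p - (pd1 F1 p + pd2 F2 p) := by
    intro p
    have := pointwise g T Z h v1 v2 w _ _ p (hTC.differentiable (by simp))
      (hZC.differentiable (by simp)) (hhC.differentiable (by simp))
      (hv1C.differentiable (by simp)) (hv2C.differentiable (by simp)) hw
      (dproj (hθ.differentiable (by simp)) p) (dproj (hz.differentiable (by simp)) p)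
      (mass p) (mom1 p) (mom2 p)
    rw [hDdef]
    linear_combination this
  have hq : ∀ p, 0 < T p * h p ∧
      0 ≤ 2⁻¹ * (v1 p * v1 p + v2 p * v2 p) + g * (Z p + h p) := by
    intro p
    have h1 : 0 < T p := hθpos (p.1, p.2.1)
    have h2 : 0 ≤ Z p := hznn (p.1, p.2.1)
    have h3 := hhpos p
    have h4 := mul_self_nonneg (v1 p)
    have h5 := mul_self_nonneg (v2 p)
    constructor <;> positivity
  have hdiv := div_thm a1 b1 a2 b2 t hab1 hab2 F1 F2 hF1C hF2C
    (fun y hy => mul_nonpos_of_nonpos_of_nonneg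
      (mul_nonpos_of_nonneg_of_nonpos (hq _).1.le (bcL y hy)) (hq _).2)
    (fun y hy => mul_nonneg (mul_nonneg (hq _).1.le (bcR y hy)) (hq _).2)
    (fun y hy => mul_nonpos_of_nonpos_of_nonneg
      (mul_nonpos_of_nonneg_of_nonpos (hq _).1.le (bcB y hy)) (hq _).2)
    (fun y hy => mul_nonneg (mul_nonneg (hq _).1.le (bcT y hy)) (hq _).2)
  have hD := pos_int a1 b1 a2 b2 hab1 hab2 (fun y => D (y.1, y.2, t)) (by fun_prop)
    (fun y => mul_nonneg (mul_nonneg (hKpos _).le (hs0 _)) (by positivity)) (by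
      obtain ⟨y, hy, hv⟩ := hex
      refine ⟨y, hy, ?_⟩
      have hp : 0 < v1 (y.1, y.2, t) ^ 2 + v2 (y.1, y.2, t) ^ 2 := by
        rcases hv with hv | hv <;> positivity
      refine mul_pos (mul_pos (hKpos _) ?_) hp
      rw [hspeed]; exact Real.sqrt_pos.2 hp)
  have hS : IsCompact (Set.Icc a1 b1 ×ˢ Set.Icc a2 b2) := isCompact_Icc.prod isCompact_Icc
  have hcd : Continuous fun p => pd1 F1 p + pd2 F2 p := by
    unfold pd1 pd2
    exact ((hF1C.continuous_fderiv (by simp)).clm_apply continuous_const).add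
      ((hF2C.continuous_fderiv (by simp)).clm_apply continuous_const)
  have hEq : (fun s => ∫ y in Set.Icc a1 b1 ×ˢ Set.Icc a2 b2,
      θ y * h (y.1, y.2, s) * E (y.1, y.2, s)) =
      fun s => ∫ y in Set.Icc a1 b1 ×ˢ Set.Icc a2 b2, G (y.1, y.2, s) := by
    funext s
    congr 1
    funext y
    rw [hE]
    simp only [hGdef, hTdef, hZdef]
    ring
  rw [hEq, deriv_under _ hS G hGC t]
  simp_rw [hpt]
  rw [integral_sub, integral_neg]
  · linarith
  · exact (by fun_prop : Continuous fun y : ℝ × ℝ => - D (y.1, y.2, t)).continuousOn.integrableOn_compact hS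
  · exact (hcd.comp (by fun_prop : Continuous fun y : ℝ × ℝ => (y.1, y.2, t))).continuousOn.integrableOn_compact hS
end
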